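/- Let T_1,…,T_n be a strongly exceptional collection in 𝒜 and set T = T_1 ⊕ ⋯ ⊕ T_n. Then T is a tilting object of 𝒜 if and only if T^⊥ = 0, i.e. if and only if every object C of 𝒜 with Hom_𝒜(T, C⟦p⟧) = 0 for all p ∈ ℤ is a zero object. -/

import Mathlib

open CategoryTheory Limits Pretriangulated

universe v u

variable {𝒜 : Type u} [Category.{v} 𝒜] [HasZeroObject 𝒜] [Preadditive 𝒜]
  [HasShift 𝒜 ℤ] [∀ n : ℤ, (shiftFunctor 𝒜 n).Additive] [Pretriangulated 𝒜]
  [HasFiniteBiproducts 𝒜]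

variable (k : Type*) [Field k] [Linear k 𝒜]

/-- A predicate on the objects of a pretriangulated category defining a strict
(= closed under isomorphisms) full triangulated subcategory. -/
def IsStrictFullTriangulatedSub (P : 𝒜 → Prop) : Prop :=
  (∀ ⦃X Y : 𝒜⦄, (X ≅ Y) → P X → P Y) ∧
  (∃ Z : 𝒜, IsZero Z ∧ P Z) ∧
  (∀ (X : 𝒜) (n : ℤ), P X → P (X⟦n⟧)) ∧
  (∀ (T : Triangle 𝒜), (T ∈ distTriang 𝒜) → P T.obj₁ → P T.obj₂ → P T.obj₃)

/-- Membership in the triangulated subcategory of `𝒜` generated by a class `S` of objects. -/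
def InTriangulatedSubGeneratedBy (S : 𝒜 → Prop) (X : 𝒜) : Prop :=
  ∀ P : 𝒜 → Prop, IsStrictFullTriangulatedSub P → (∀ ⦃Y : 𝒜⦄, S Y → P Y) → P X

/-- An object `T` of `𝒜` is a tilting object if `Hom(T, T⟦i⟧) = 0` for all `i ≠ 0` and the
smallest strict full triangulated subcategory of `𝒜` containing all direct summands of `T`
is `𝒜` itself. -/
def IsTiltingObject (T : 𝒜) : Prop :=
  (∀ i : ℤ, i ≠ 0 → ∀ f : T ⟶ T⟦i⟧, f = 0) ∧
  (∀ A : 𝒜, InTriangulatedSubGeneratedBy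
    (fun X => ∃ (s : X ⟶ T) (r : T ⟶ X), s ≫ r = 𝟙 X) A)

set_option linter.unusedSectionVars false

/-- Vanishing of `Hom(X, Y⟦s⟧)` implies vanishing of `Hom(X⟦q⟧, Y⟦r⟧)` when `s + q = r`. -/
lemma shift_hom_eq_zero {X Y : 𝒜} {s q r : ℤ} (h : ∀ f : X ⟶ Y⟦s⟧, f = 0) (hr : s + q = r)
    (f : X⟦q⟧ ⟶ Y⟦r⟧) : f = 0 := by
  have e := (shiftFunctorAdd' 𝒜 s q r hr).app Y
  obtain ⟨g, hg⟩ := (shiftFunctor 𝒜 q).map_surjective (f ≫ e.hom)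
  rw [h g, Functor.map_zero] at hg
  exact (cancel_mono e.hom).1 (by rw [← hg, zero_comp])

/-- Vanishing of `Hom(X, Y⟦s⟧)` implies vanishing of `Hom(X⟦q⟧, Y)` when `s + q = 0`. -/
lemma shift_hom_eq_zero_of_add_eq_zero {X Y : 𝒜} {s q : ℤ} (h : ∀ f : X ⟶ Y⟦s⟧, f = 0)
    (hr : s + q = 0) (f : X⟦q⟧ ⟶ Y) : f = 0 := by
  have e := (shiftFunctorZero 𝒜 ℤ).app Y
  exact (cancel_mono e.inv).1 (by rw [shift_hom_eq_zero h hr (f ≫ e.inv), zero_comp])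

/-- Vanishing of `Hom(X⟦q⟧, Y)` implies vanishing of `Hom(X, Y⟦s⟧)` when `s + q = 0`. -/
lemma hom_shift_eq_zero_of_add_eq_zero {X Y : 𝒜} {s q : ℤ} (h : ∀ f : X⟦q⟧ ⟶ Y, f = 0)
    (hr : s + q = 0) (f : X ⟶ Y⟦s⟧) : f = 0 := by
  have e : Y⟦s⟧⟦q⟧ ≅ Y := (shiftFunctorCompIsoId 𝒜 s q hr).app Y
  apply (shiftFunctor 𝒜 q).map_injective
  rw [Functor.map_zero]
  exact (cancel_mono e.hom).1 (by rw [h (f⟦q⟧' ≫ e.hom), zero_comp])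

/-- If nonzero endomorphisms of `E` are invertible, then so are nonzero morphisms
`E⟦p + 1⟧ ⟶ E⟦p⟧⟦1⟧`. -/
lemma isIso_of_ne_zero_shift {E : 𝒜} (hdiv : ∀ f : E ⟶ E, f ≠ 0 → IsIso f) (p : ℤ)
    (f : E⟦p + 1⟧ ⟶ E⟦p⟧⟦(1 : ℤ)⟧) (hf : f ≠ 0) : IsIso f := by
  have e : E⟦p + 1⟧ ≅ E⟦p⟧⟦(1 : ℤ)⟧ := (shiftFunctorAdd 𝒜 p 1).app E
  obtain ⟨g, hg⟩ := (shiftFunctor 𝒜 (p + 1)).map_surjective (f ≫ e.inv)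
  have hg0 : g ≠ 0 := by
    rintro rfl
    rw [Functor.map_zero] at hg
    exact hf ((cancel_mono e.inv).1 (by rw [← hg, zero_comp]))
  have := hdiv g hg0
  have hfg : f = (shiftFunctor 𝒜 (p + 1)).map g ≫ e.hom := by simp [hg]
  rw [hfg]
  infer_instance

namespace IsStrictFullTriangulatedSub

variable {P : 𝒜 → Prop}

lemma of_iso (hP : IsStrictFullTriangulatedSub P) {X Y : 𝒜} (e : X ≅ Y) (h : P X) : P Y :=
  hP.1 e h

lemma of_isZero (hP : IsStrictFullTriangulatedSub P) {X : 𝒜} (h : IsZero X) : P X := by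
  obtain ⟨Z, hZ, hPZ⟩ := hP.2.1
  exact hP.of_iso (hZ.iso h) hPZ

lemma shift (hP : IsStrictFullTriangulatedSub P) {X : 𝒜} (h : P X) (n : ℤ) : P (X⟦n⟧) :=
  hP.2.2.1 X n h

lemma obj₂ (hP : IsStrictFullTriangulatedSub P) {D : Triangle 𝒜} (hD : D ∈ distTriang 𝒜)
    (h₁ : P D.obj₁) (h₃ : P D.obj₃) : P D.obj₂ :=
  hP.2.2.2 _ (inv_rot_of_distTriang D hD) (hP.shift h₃ (-1)) h₁

end IsStrictFullTriangulatedSub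

open scoped ZeroObject in
/-- The left orthogonal of an object is a strict full triangulated subcategory. -/
lemma isStrictFullTriangulatedSub_leftOrthogonal (C : 𝒜) :
    IsStrictFullTriangulatedSub (fun X : 𝒜 => ∀ (p : ℤ) (f : X ⟶ C⟦p⟧), f = 0) := by
  refine ⟨fun X Y e h p f => ?_, ⟨0, isZero_zero _, fun p f => (isZero_zero 𝒜).eq_of_src _ _⟩,
    fun X n h p f => shift_hom_eq_zero (h (p - n)) (by lia) f, fun D hD h₁ h₂ p f => ?_⟩
  · exact (cancel_epi e.hom).1 (by rw [h p (e.hom ≫ f), comp_zero])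
  · obtain ⟨g, rfl⟩ := D.yoneda_exact₃ hD f (h₂ p _)
    rw [shift_hom_eq_zero (h₁ (p - 1)) (by lia) g, comp_zero]

/-- Killing a nonzero morphism `f : E⟦p⟧ ⟶ A` out of a shift of an exceptional object induces
surjections on the spaces of morphisms from the shifts of `E`. -/
lemma comp_surjective_of_exceptional {E A B : 𝒜} (hdiv : ∀ f : E ⟶ E, f ≠ 0 → IsIso f)
    (hE : ∀ p : ℤ, p ≠ 0 → ∀ f : E ⟶ E⟦p⟧, f = 0) {p : ℤ} {f : E⟦p⟧ ⟶ A} (hf : f ≠ 0)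
    {g : A ⟶ B} {h : B ⟶ E⟦p⟧⟦(1 : ℤ)⟧} (hD : Triangle.mk f g h ∈ distTriang 𝒜) (q : ℤ)
    (y : E⟦q⟧ ⟶ B) : ∃ x : E⟦q⟧ ⟶ A, x ≫ g = y := by
  suffices hy : y ≫ h = 0 by
    obtain ⟨x, hx⟩ := Triangle.coyoneda_exact₃ _ hD y hy
    exact ⟨x, hx.symm⟩
  by_cases hq : q = p + 1
  · subst hq
    by_contra hne
    have := isIso_of_ne_zero_shift hdiv p _ hne
    apply hf
    apply (shiftFunctor 𝒜 (1 : ℤ)).map_injective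
    have hz : h ≫ f⟦(1 : ℤ)⟧' = 0 := comp_distTriang_mor_zero₃₁ _ hD
    rw [Functor.map_zero, ← cancel_epi (y ≫ h), Category.assoc, hz, comp_zero, comp_zero]
  · have e : E⟦p + 1⟧ ≅ E⟦p⟧⟦(1 : ℤ)⟧ := (shiftFunctorAdd 𝒜 p 1).app E
    refine (cancel_mono e.inv).1 ?_
    rw [zero_comp]
    exact shift_hom_eq_zero (hE (p + 1 - q) (by lia)) (by lia) _

/-- Reduction to the right orthogonal of an exceptional object `E`: if `Q` is stable under
taking cones of morphisms out of shifts of `E`, then every object satisfying `Q` lies in `P` as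
soon as those which are right orthogonal to `E` do. -/
lemma IsStrictFullTriangulatedSub.of_exceptional {P Q : 𝒜 → Prop}
    (hP : IsStrictFullTriangulatedSub P)
    (hfin : ∀ X Y : 𝒜, FiniteDimensional k (X ⟶ Y))
    (hbdd : ∀ X Y : 𝒜, {i : ℤ | ∃ f : X ⟶ Y⟦i⟧, f ≠ 0}.Finite)
    {E : 𝒜} (hPE : P E) (hdiv : ∀ f : E ⟶ E, f ≠ 0 → IsIso f)
    (hE : ∀ p : ℤ, p ≠ 0 → ∀ f : E ⟶ E⟦p⟧, f = 0)
    (hQ : ∀ (p : ℤ) (A B : 𝒜) (f : E⟦p⟧ ⟶ A) (g : A ⟶ B) (h : B ⟶ E⟦p⟧⟦(1 : ℤ)⟧),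
      Triangle.mk f g h ∈ distTriang 𝒜 → Q A → Q B)
    (hperp : ∀ A : 𝒜, Q A → (∀ (q : ℤ) (f : E⟦q⟧ ⟶ A), f = 0) → P A)
    {A : 𝒜} (hA : Q A) : P A := by
  have key : ∀ (S : Finset ℤ) (N : ℕ) (A : 𝒜), Q A → (∀ q ∉ S, ∀ f : E⟦q⟧ ⟶ A, f = 0) →
      ∑ q ∈ S, Module.finrank k (E⟦q⟧ ⟶ A) = N → P A := by
    intro S N
    induction N using Nat.strong_induction_on with
    | _ N ih =>
    intro A hA hS hN
    by_cases hz : ∀ (q : ℤ) (f : E⟦q⟧ ⟶ A), f = 0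
    · exact hperp A hA hz
    push Not at hz
    obtain ⟨p, f, hf⟩ := hz
    obtain ⟨B, g, h, hD⟩ := distinguished_cocone_triangle f
    have hsurj := comp_surjective_of_exceptional hdiv hE hf hD
    have hp : p ∈ S := by
      by_contra hp
      exact hf (hS p hp f)
    refine hP.obj₂ hD (hP.shift hPE p) (ih _ ?_ B (hQ p A B f g h hD hA) ?_ rfl)
    · rw [← hN]
      refine Finset.sum_lt_sum (fun q _ => ?_) ⟨p, hp, ?_⟩
      · exact LinearMap.finrank_le_finrank_of_surjective (f := Linear.rightComp k (E⟦q⟧) g)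
          (hsurj q)
      · by_contra hle
        have heq : Module.finrank k (E⟦p⟧ ⟶ A) = Module.finrank k (E⟦p⟧ ⟶ B) :=
          le_antisymm (not_lt.1 hle) (LinearMap.finrank_le_finrank_of_surjective
            (f := Linear.rightComp k (E⟦p⟧) g) (hsurj p))
        have hinj := (LinearMap.injective_iff_surjective_of_finrank_eq_finrank
          (f := Linear.rightComp k (E⟦p⟧) g) heq).2 (hsurj p)
        have hfg : f ≫ g = 0 := comp_distTriang_mor_zero₁₂ _ hD
        exact hf (hinj (by simp [hfg]))
    · intro q hq y
      obtain ⟨x, rfl⟩ := hsurj q y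
      rw [hS q hq x, zero_comp]
  refine key ((hbdd E A).toFinset.image (fun i => -i)) _ A hA (fun q hq => ?_) rfl
  refine shift_hom_eq_zero_of_add_eq_zero (s := -q) (fun f => ?_) (by lia)
  by_contra hf
  exact hq (Finset.mem_image.2 ⟨-q, by simpa using ⟨f, hf⟩, by lia⟩)

/-- Let `T_1, …, T_n` be a strongly exceptional collection in `𝒜` and `T = T_1 ⊕ ⋯ ⊕ T_n`.
Then `T` is a tilting object if and only if `T^⊥ = 0`, i.e. if and only if every object `C`
with `Hom(T, C⟦p⟧) = 0` for all `p ∈ ℤ` is a zero object. -/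
theorem stronglyExceptional_tilting_iff_perp_zero
    (hfin : ∀ X Y : 𝒜, FiniteDimensional k (X ⟶ Y))
    (hbdd : ∀ X Y : 𝒜, {i : ℤ | ∃ f : X ⟶ Y⟦i⟧, f ≠ 0}.Finite)
    (n : ℕ) (T : Fin n → 𝒜)
    (hdiv : ∀ i, ((𝟙 (T i) : T i ⟶ T i) ≠ 0 ∧
      ∀ f : T i ⟶ T i, f ≠ 0 → ∃ g : T i ⟶ T i, f ≫ g = 𝟙 (T i) ∧ g ≫ f = 𝟙 (T i)))
    (hstrong : ∀ (i j : Fin n) (p : ℤ), p ≠ 0 → ∀ f : T i ⟶ (T j)⟦p⟧, f = 0)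
    (hcoll : ∀ i j : Fin n, i < j → ∀ f : T i ⟶ T j, f = 0) :
    IsTiltingObject (⨁ T) ↔
      (∀ C : 𝒜, (∀ (p : ℤ) (f : (⨁ T) ⟶ C⟦p⟧), f = 0) → IsZero C) := by
  have hι (i : Fin n) : ∃ (s : T i ⟶ ⨁ T) (r : (⨁ T) ⟶ T i), s ≫ r = 𝟙 (T i) :=
    ⟨biproduct.ι T i, biproduct.π T i, biproduct.ι_π_self T i⟩
  constructor
  · rintro ⟨-, hgen⟩ C hC
    have h := hgen C _ (isStrictFullTriangulatedSub_leftOrthogonal C) (by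
      rintro X ⟨s, r, hsr⟩ p f
      rw [← Category.id_comp f, ← hsr, Category.assoc, hC p (r ≫ f), comp_zero])
    have e : C⟦(0 : ℤ)⟧ ≅ C := (shiftFunctorZero 𝒜 ℤ).app C
    exact (IsZero.iff_id_eq_zero C).2 ((cancel_mono e.inv).1 (by
      rw [h 0 (𝟙 C ≫ e.inv), zero_comp]))
  · intro hperp
    refine ⟨fun p hp f => ?_, fun A P hP hTP => ?_⟩
    · refine biproduct.hom_ext' _ _ fun i => ?_
      rw [← Category.comp_id (biproduct.ι T i ≫ f), ← (shiftFunctor 𝒜 p).map_id, ← biproduct.total,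
        Functor.map_sum, Preadditive.comp_sum, comp_zero]
      refine Finset.sum_eq_zero fun j _ => ?_
      rw [Functor.map_comp, ← Category.assoc, hstrong i j p hp (_ ≫ _), zero_comp]
    · have key : ∀ d m : ℕ, m + d = n → ∀ A : 𝒜,
          (∀ i : Fin n, i.val < m → ∀ (q : ℤ) (f : (T i)⟦q⟧ ⟶ A), f = 0) → P A := by
        intro d
        induction d with
        | zero =>
          intro m hm A hA
          refine hP.of_isZero (hperp A fun p f => biproduct.hom_ext' _ _ fun i => ?_)
          rw [comp_zero]
          exact hom_shift_eq_zero_of_add_eq_zero (hA i (by lia) (-p)) (by lia) _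
        | succ d ih =>
          intro m hm A hA
          have hmn : m < n := by lia
          refine hP.of_exceptional k hfin hbdd
            (Q := fun A => ∀ i : Fin n, i.val < m → ∀ (q : ℤ) (f : (T i)⟦q⟧ ⟶ A), f = 0)
            (hTP (hι ⟨m, hmn⟩)) (fun f hf => ⟨(hdiv _).2 f hf⟩) (hstrong _ _) ?_ ?_ hA
          · intro p A B f g h hD hA i hi q y
            have hT (s : ℤ) (z : T i ⟶ (T ⟨m, hmn⟩)⟦s⟧) : z = 0 := by
              by_cases hs : s = 0
              · subst hs
                have e := (shiftFunctorZero 𝒜 ℤ).app (T ⟨m, hmn⟩)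
                exact (cancel_mono e.hom).1 (by
                  rw [hcoll i ⟨m, hmn⟩ hi (z ≫ e.hom), zero_comp])
              · exact hstrong _ _ s hs z
            have e : (T ⟨m, hmn⟩)⟦p + 1⟧ ≅ (T ⟨m, hmn⟩)⟦p⟧⟦(1 : ℤ)⟧ :=
              (shiftFunctorAdd 𝒜 p 1).app _
            have hy : y ≫ h = 0 := (cancel_mono e.inv).1 (by
              rw [zero_comp]
              exact shift_hom_eq_zero (hT (p + 1 - q)) (by lia) _)
            obtain ⟨x, hx⟩ := Triangle.coyoneda_exact₃ _ hD y hy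
            rw [hx, hA i hi q x]
            exact zero_comp
          · intro A hA hm'
            refine ih (m + 1) (by lia) A fun i hi => ?_
            rcases Nat.lt_succ_iff_lt_or_eq.1 hi with hlt | heq
            · exact hA i hlt
            · obtain rfl : i = ⟨m, hmn⟩ := Fin.ext heq
              exact hm'
      exact key n 0 (by lia) A (fun i hi => absurd hi (Nat.not_lt_zero _))
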